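/- arXiv:2311.10772 — 2 statements merged into one kernel-verified Lean document; each statement's English description precedes it below -/
import Mathlib

section
/- Let A' be the second intersection point (distinct from A) of the circumcircles of triangles AB₁C₁ and AB₂C₂ (and B', C' defined analogously), and let R be the common point of the lines AA', BB', CC'. Then R is equidistant from P and Q, i.e. RP = RQ. -/
open EuclideanGeometry

lemma dist_eq_dist_iff_coords {X Y O : ℂ} :
    dist X O = dist Y O ↔
      (X.re - O.re) ^ 2 + (X.im - O.im) ^ 2 = (Y.re - O.re) ^ 2 + (Y.im - O.im) ^ 2 := by
  rw [Complex.dist_eq_re_im, Complex.dist_eq_re_im, Real.sqrt_inj (by positivity) (by positivity)]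

lemma sq_add_sq_coords_ne_zero {X Y : ℂ} (h : X ≠ Y) :
    (Y.re - X.re) ^ 2 + (Y.im - X.im) ^ 2 ≠ 0 := by
  intro e
  apply h
  apply Complex.ext <;> nlinarith [sq_nonneg (Y.re - X.re), sq_nonneg (Y.im - X.im)]

lemma exists_center_of_cospherical {X Y Z W : ℂ} (h : Cospherical ({X, Y, Z, W} : Set ℂ)) :
    ∃ O : ℂ, dist X O = dist W O ∧ dist Y O = dist W O ∧ dist Z O = dist W O := by
  obtain ⟨O, r, h⟩ := h
  have hX := h X (by simp)
  have hY := h Y (by simp)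
  have hZ := h Z (by simp)
  have hW := h W (by simp)
  exact ⟨O, hX.trans hW.symm, hY.trans hW.symm, hZ.trans hW.symm⟩

lemma exists_coords_of_mem_line {X Y Z : ℂ} (h : Z ∈ line[ℝ, X, Y]) :
    ∃ t : ℝ, Z.re = X.re + t * (Y.re - X.re) ∧ Z.im = X.im + t * (Y.im - X.im) := by
  obtain ⟨t, rfl⟩ := mem_affineSpan_pair_iff_exists_lineMap_eq.1 h
  refine ⟨t, ?_, ?_⟩ <;> simp [AffineMap.lineMap_apply] <;> ring

/-- Twice the signed area of the triangle `ABC`. -/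
def cross (A B C : ℂ) : ℝ :=
  (B.re - A.re) * (C.im - A.im) - (B.im - A.im) * (C.re - A.re)

lemma cross_rotate (A B C : ℂ) : cross B C A = cross A B C := by
  unfold cross; ring

lemma cross_eq_zero_of_mem_line {X Y Z : ℂ} (h : Z ∈ line[ℝ, X, Y]) : cross X Y Z = 0 := by
  obtain ⟨t, h1, h2⟩ := exists_coords_of_mem_line h
  rw [cross, h1, h2]; ring

lemma exists_coords_of_cross_eq_zero {X Y Z : ℂ} (hXY : X ≠ Y) (h : cross X Y Z = 0) :
    ∃ t : ℝ, Z.re = X.re + t * (Y.re - X.re) ∧ Z.im = X.im + t * (Y.im - X.im) := by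
  have hne := sq_add_sq_coords_ne_zero hXY
  unfold cross at h
  refine ⟨((Y.re - X.re) * (Z.re - X.re) + (Y.im - X.im) * (Z.im - X.im)) /
    ((Y.re - X.re) ^ 2 + (Y.im - X.im) ^ 2), ?_, ?_⟩ <;> field_simp
  · linear_combination (-(Y.im - X.im)) * h
  · linear_combination (Y.re - X.re) * h

lemma cross_ne_zero_of_affineIndependent {A B C : ℂ} (h : AffineIndependent ℝ ![A, B, C]) :
    cross A B C ≠ 0 := by
  intro h0
  have hAB : A ≠ B := by simpa using h.injective.ne (show (0 : Fin 3) ≠ 1 by decide)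
  obtain ⟨t, h1, h2⟩ := exists_coords_of_cross_eq_zero hAB h0
  rw [affineIndependent_iff_not_collinear_set] at h
  apply h
  rw [collinear_iff_of_mem (p₀ := A) (by simp)]
  refine ⟨B - A, ?_⟩
  simp only [Set.mem_insert_iff, Set.mem_singleton_iff, forall_eq_or_imp, forall_eq]
  refine ⟨⟨0, by simp⟩, ⟨1, by simp⟩, t, ?_⟩
  apply Complex.ext <;> simp [h1, h2] <;> ring

/-- Three distinct points at the same distance from a point are not collinear. -/
lemma cross_ne_zero_of_dist_eq {X Y Z O : ℂ} (hXY : X ≠ Y) (hXZ : X ≠ Z) (hYZ : Y ≠ Z)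
    (h1 : dist X O = dist Z O) (h2 : dist Y O = dist Z O) : cross X Y Z ≠ 0 := by
  intro h
  obtain ⟨t, ht1, ht2⟩ := exists_coords_of_cross_eq_zero hXY h
  rw [dist_eq_dist_iff_coords, ht1, ht2] at h1 h2
  have key : t * (t - 1) * ((Y.re - X.re) ^ 2 + (Y.im - X.im) ^ 2) = 0 := by
    linear_combination (t - 1) * h1 - t * h2
  rcases mul_eq_zero.1 ((mul_eq_zero.1 key).resolve_right (sq_add_sq_coords_ne_zero hXY))
    with h0 | h0
  · exact hXZ (Complex.ext (by simp [ht1, h0]) (by simp [ht2, h0]))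
  · obtain rfl : t = 1 := by linarith
    exact hYZ (Complex.ext (by simp [ht1]) (by simp [ht2]))

lemma center_unique {X Y Z O O' : ℂ} (h : cross X Y Z ≠ 0)
    (h1 : dist X O = dist Z O) (h2 : dist Y O = dist Z O)
    (hX : dist X O' = dist Z O') (hY : dist Y O' = dist Z O') : O = O' := by
  rw [dist_eq_dist_iff_coords] at *
  unfold cross at h
  apply Complex.ext <;> apply mul_left_cancel₀ h
  · linear_combination (1/2) * ((Z.im - Y.im) * (h1 - hX) - (Z.im - X.im) * (h2 - hY))
  · linear_combination (1/2) * (-(Z.re - Y.re) * (h1 - hX) + (Z.re - X.re) * (h2 - hY))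

/-- The point `P + (1 / 2 + k * I) * (A - P)`. These are the points equidistant from `A` and
`P`. -/
noncomputable def pivotCenter (k : ℝ) (A P : ℂ) : ℂ :=
  ⟨(A.re + P.re) / 2 - k * (A.im - P.im), (A.im + P.im) / 2 + k * (A.re - P.re)⟩

lemma dist_pivotCenter (k : ℝ) (A P : ℂ) :
    dist A (pivotCenter k A P) = dist P (pivotCenter k A P) := by
  rw [dist_eq_dist_iff_coords]
  simp only [pivotCenter]; ring

lemma exists_eq_pivotCenter {A P O : ℂ} (hAP : A ≠ P) (h : dist A O = dist P O) :
    ∃ k : ℝ, O = pivotCenter k A P := by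
  rw [dist_eq_dist_iff_coords] at h
  have hne := sq_add_sq_coords_ne_zero hAP.symm
  refine ⟨((O.im - P.im) * (A.re - P.re) - (O.re - P.re) * (A.im - P.im)) /
    ((A.re - P.re) ^ 2 + (A.im - P.im) ^ 2), ?_⟩
  apply Complex.ext <;> simp only [pivotCenter] <;> field_simp
  · linear_combination (-(A.re - P.re)) * h
  · linear_combination (-(A.im - P.im)) * h

/-- If circles through `A`, `P` and `B`, `P` share a second point `Z` on `AB`, then the
similarities with centre `P` taking `A`, `B` to the centres of the circles agree. -/
lemma pivot_eq {A B P Z : ℂ} {k l : ℝ} (hZ : Z ∈ line[ℝ, A, B])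
    (hZA : A ≠ Z) (hZB : B ≠ Z) (hPA : A ≠ P) (hPZ : Z ≠ P)
    (hA : dist Z (pivotCenter k A P) = dist P (pivotCenter k A P))
    (hB : dist Z (pivotCenter l B P) = dist P (pivotCenter l B P)) : k = l := by
  have hc := cross_ne_zero_of_dist_eq hZA hPA hPZ (dist_pivotCenter k A P) hA
  obtain ⟨t, h1, h2⟩ := exists_coords_of_mem_line hZ
  have ht0 : t ≠ 0 := by
    rintro rfl
    exact hZA (Complex.ext (by simp [h1]) (by simp [h2]))
  have ht1 : 1 - t ≠ 0 := by
    intro h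
    obtain rfl : t = 1 := by linarith
    exact hZB (Complex.ext (by simp [h1]) (by simp [h2]))
  rw [dist_eq_dist_iff_coords] at hA hB
  simp only [pivotCenter, cross, h1, h2] at hA hB hc
  have hc' : (A.re - P.re) * (B.im - P.im) - (A.im - P.im) * (B.re - P.re) ≠ 0 := by
    intro h
    apply hc
    linear_combination t * h
  apply mul_left_cancel₀ hc'
  apply mul_left_cancel₀ ht0
  apply mul_left_cancel₀ ht1
  linear_combination (-(1 - t) / 2) * hA - t / 2 * hB

lemma ne_of_dist_eq {A B Z P O : ℂ} (hZ : Z ∈ line[ℝ, A, B]) (hAB : A ≠ B) (hAZ : A ≠ Z)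
    (hBZ : B ≠ Z) (h1 : dist B O = dist P O) (h2 : dist Z O = dist P O) : A ≠ P := by
  rintro rfl
  exact cross_ne_zero_of_dist_eq hAB hAZ hBZ h2.symm (h1.trans h2.symm)
    (cross_eq_zero_of_mem_line hZ)

/-- The circles in Miquel's theorem have as centres the images of the vertices under a common
similarity with centre the Miquel point. -/
lemma exists_pivotCenter_of_miquel {A B C A₁ B₁ C₁ P : ℂ}
    (hAB : A ≠ B) (hBC : B ≠ C) (hCA : C ≠ A)
    (hA₁ : A₁ ∈ line[ℝ, B, C]) (hB₁ : B₁ ∈ line[ℝ, C, A]) (hC₁ : C₁ ∈ line[ℝ, A, B])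
    (hBA₁ : B ≠ A₁) (hCA₁ : C ≠ A₁) (hCB₁ : C ≠ B₁) (hAB₁ : A ≠ B₁) (hAC₁ : A ≠ C₁)
    (hBC₁ : B ≠ C₁) (hA₁B₁ : A₁ ≠ B₁) (hA₁C₁ : A₁ ≠ C₁) (hB₁C₁ : B₁ ≠ C₁)
    (hPA : Cospherical ({A, B₁, C₁, P} : Set ℂ))
    (hPB : Cospherical ({B, C₁, A₁, P} : Set ℂ))
    (hPC : Cospherical ({C, A₁, B₁, P} : Set ℂ)) :
    ∃ k : ℝ,
      (dist A (pivotCenter k A P) = dist C₁ (pivotCenter k A P) ∧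
        dist B₁ (pivotCenter k A P) = dist C₁ (pivotCenter k A P)) ∧
      (dist B (pivotCenter k B P) = dist A₁ (pivotCenter k B P) ∧
        dist C₁ (pivotCenter k B P) = dist A₁ (pivotCenter k B P)) ∧
      (dist C (pivotCenter k C P) = dist B₁ (pivotCenter k C P) ∧
        dist A₁ (pivotCenter k C P) = dist B₁ (pivotCenter k C P)) := by
  obtain ⟨Oa, a1, a2, a3⟩ := exists_center_of_cospherical hPA
  obtain ⟨Ob, b1, b2, b3⟩ := exists_center_of_cospherical hPB
  obtain ⟨Oc, c1, c2, c3⟩ := exists_center_of_cospherical hPC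
  have hA := ne_of_dist_eq hC₁ hAB hAC₁ hBC₁ b1 b2
  have hB := ne_of_dist_eq hA₁ hBC hBA₁ hCA₁ c1 c2
  have hC := ne_of_dist_eq hB₁ hCA hCB₁ hAB₁ a1 a2
  obtain ⟨k, rfl⟩ := exists_eq_pivotCenter hA a1
  obtain ⟨l, rfl⟩ := exists_eq_pivotCenter hB b1
  obtain ⟨m, rfl⟩ := exists_eq_pivotCenter hC c1
  have kl : C₁ ≠ P → k = l := fun h => pivot_eq hC₁ hAC₁ hBC₁ hA h a3 b2
  have lm : A₁ ≠ P → l = m := fun h => pivot_eq hA₁ hBA₁ hCA₁ hB h b3 c2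
  have mk : B₁ ≠ P → m = k := fun h => pivot_eq hB₁ hCB₁ hAB₁ hC h c3 a2
  have key : k = l ∧ k = m := by
    by_cases h1 : A₁ = P
    · subst h1
      have e1 := kl hA₁C₁.symm
      have e2 := mk hA₁B₁.symm
      exact ⟨e1, e2.symm⟩
    · by_cases h2 : B₁ = P
      · subst h2
        have e1 := kl hB₁C₁.symm
        exact ⟨e1, e1.trans (lm h1)⟩
      · exact ⟨((lm h1).trans (mk h2)).symm, (mk h2).symm⟩
  obtain ⟨rfl, rfl⟩ := key
  exact ⟨k, ⟨a1.trans a3.symm, a2.trans a3.symm⟩, ⟨b1.trans b3.symm, b2.trans b3.symm⟩,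
    c1.trans c3.symm, c2.trans c3.symm⟩

/-- If circles with centres `U`, `V` through `A` meet a line through `A` again at points `Z`, `Z'`
of a circle with centre `O`, the product of the projections of `U - A` and `V - A` onto the line is
determined by the power of `A` in the latter circle. -/
lemma inner_mul_inner_eq {A B Z Z' O U V : ℂ} (hZ : Z ∈ line[ℝ, A, B])
    (hZ' : Z' ∈ line[ℝ, A, B]) (hne : Z ≠ Z') (hAZ : A ≠ Z) (hAZ' : A ≠ Z')
    (hO : dist Z O = dist Z' O) (hU : dist A U = dist Z U) (hV : dist A V = dist Z' V) :
    4 * ((U.re - A.re) * (B.re - A.re) + (U.im - A.im) * (B.im - A.im)) *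
      ((V.re - A.re) * (B.re - A.re) + (V.im - A.im) * (B.im - A.im)) =
    ((A.re - O.re) ^ 2 + (A.im - O.im) ^ 2 - ((Z.re - O.re) ^ 2 + (Z.im - O.im) ^ 2)) *
      ((B.re - A.re) ^ 2 + (B.im - A.im) ^ 2) := by
  obtain ⟨x, hx1, hx2⟩ := exists_coords_of_mem_line hZ
  obtain ⟨y, hy1, hy2⟩ := exists_coords_of_mem_line hZ'
  have hx : x ≠ 0 := by
    rintro rfl
    exact hAZ (Complex.ext (by simp [hx1]) (by simp [hx2]))
  have hy : y ≠ 0 := by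
    rintro rfl
    exact hAZ' (Complex.ext (by simp [hy1]) (by simp [hy2]))
  have hxy : x - y ≠ 0 := by
    intro h
    obtain rfl : x = y := by linarith
    exact hne (Complex.ext (by simp [hx1, hy1]) (by simp [hx2, hy2]))
  rw [dist_eq_dist_iff_coords] at hO hU hV
  simp only [hx1, hx2, hy1, hy2] at hO hU hV ⊢
  have eU : 2 * ((U.re - A.re) * (B.re - A.re) + (U.im - A.im) * (B.im - A.im)) =
      x * ((B.re - A.re) ^ 2 + (B.im - A.im) ^ 2) := by
    apply mul_left_cancel₀ hx
    linear_combination hU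
  have eV : 2 * ((V.re - A.re) * (B.re - A.re) + (V.im - A.im) * (B.im - A.im)) =
      y * ((B.re - A.re) ^ 2 + (B.im - A.im) ^ 2) := by
    apply mul_left_cancel₀ hy
    linear_combination hV
  have eO : 2 * ((A.re - O.re) * (B.re - A.re) + (A.im - O.im) * (B.im - A.im)) =
      -(x + y) * ((B.re - A.re) ^ 2 + (B.im - A.im) ^ 2) := by
    apply mul_left_cancel₀ hxy
    linear_combination hO
  linear_combination
    2 * ((V.re - A.re) * (B.re - A.re) + (V.im - A.im) * (B.im - A.im)) * eU +
      x * ((B.re - A.re) ^ 2 + (B.im - A.im) ^ 2) * (eV + eO)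

lemma exists_real_mul_eq {A B C B₁ B₂ C₁ C₂ O U V : ℂ} (hABC : cross A B C ≠ 0)
    (hAB : A ≠ B) (hAC : A ≠ C)
    (hB₁ : B₁ ∈ line[ℝ, C, A]) (hB₂ : B₂ ∈ line[ℝ, C, A])
    (hC₁ : C₁ ∈ line[ℝ, A, B]) (hC₂ : C₂ ∈ line[ℝ, A, B])
    (hAB₁ : A ≠ B₁) (hAB₂ : A ≠ B₂) (hAC₁ : A ≠ C₁) (hAC₂ : A ≠ C₂)
    (hB : B₁ ≠ B₂) (hC : C₁ ≠ C₂)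
    (hOB : dist B₁ O = dist B₂ O) (hOC : dist C₁ O = dist C₂ O) (hO : dist B₁ O = dist C₁ O)
    (hU : dist A U = dist C₁ U ∧ dist B₁ U = dist C₁ U)
    (hV : dist A V = dist C₂ V ∧ dist B₂ V = dist C₂ V) :
    ∃ r : ℝ, (U - A) * (V - A) = r * ((B - A) * (C - A)) := by
  rw [Set.pair_comm] at hB₁ hB₂
  have e1 := inner_mul_inner_eq hC₁ hC₂ hC hAC₁ hAC₂ hOC hU.1 hV.1
  have e2 := inner_mul_inner_eq hB₁ hB₂ hB hAB₁ hAB₂ hOB (hU.1.trans hU.2.symm)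
    (hV.1.trans hV.2.symm)
  rw [dist_eq_dist_iff_coords] at hO
  rw [hO] at e2
  have him : ((U - A) * (V - A) * (starRingEnd ℂ) ((B - A) * (C - A))).im = 0 := by
    unfold cross at hABC
    apply mul_left_cancel₀ hABC
    simp only [map_mul, map_sub, Complex.mul_im, Complex.mul_re, Complex.sub_re, Complex.sub_im,
      Complex.conj_re, Complex.conj_im]
    linear_combination (1 / 4) * ((B.re - A.re) ^ 2 + (B.im - A.im) ^ 2) * e2 -
      (1 / 4) * ((C.re - A.re) ^ 2 + (C.im - A.im) ^ 2) * e1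
  have hv : (B - A) * (C - A) ≠ 0 :=
    mul_ne_zero (sub_ne_zero.2 hAB.symm) (sub_ne_zero.2 hAC.symm)
  generalize (B - A) * (C - A) = v at *
  generalize (U - A) * (V - A) = u at *
  refine ⟨(u / v).re, ?_⟩
  have h : ((u / v).re : ℂ) = u / v := by
    apply Complex.ext
    · simp
    · rw [Complex.ofReal_im, div_eq_mul_inv, Complex.inv_def, ← mul_assoc, Complex.im_mul_ofReal,
        him, zero_mul]
  rw [h, div_mul_cancel₀ _ hv]

lemma pivotCenter_sub (k : ℝ) (A P : ℂ) :
    pivotCenter k A P - A = (1 / 2 - k * Complex.I) * (P - A) := by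
  apply Complex.ext <;> simp [pivotCenter] <;> ring

lemma pivot_add_eq_zero {A B C P Q : ℂ} {k l a b c : ℝ}
    (hAB : A ≠ B) (hBC : B ≠ C) (hCA : C ≠ A)
    (ha : (pivotCenter k A P - A) * (pivotCenter l A Q - A) = a * ((B - A) * (C - A)))
    (hb : (pivotCenter k B P - B) * (pivotCenter l B Q - B) = b * ((C - B) * (A - B)))
    (hc : (pivotCenter k C P - C) * (pivotCenter l C Q - C) = c * ((A - C) * (B - C))) :
    l = -k := by
  simp only [pivotCenter_sub] at ha hb hc
  have key : (1 / 2 - k * Complex.I) * (1 / 2 - l * Complex.I) = ((a + b + c : ℝ) : ℂ) := by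
    apply mul_left_cancel₀ (mul_ne_zero (mul_ne_zero (sub_ne_zero.2 hAB) (sub_ne_zero.2 hBC))
      (sub_ne_zero.2 hCA))
    push_cast
    linear_combination (-(B - C)) * ha - (C - A) * hb - (A - B) * hc
  have h := congrArg Complex.im key
  simp at h
  linarith

/-- A point `R` of the line through two common points `A`, `A'` of two circles has the same power
in both. -/
lemma power_eq_of_mem_line {A A' R U V : ℂ} (hR : R ∈ line[ℝ, A, A'])
    (hU : dist A U = dist A' U) (hV : dist A V = dist A' V) :
    ((R.re - U.re) ^ 2 + (R.im - U.im) ^ 2) - ((A.re - U.re) ^ 2 + (A.im - U.im) ^ 2) =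
      ((R.re - V.re) ^ 2 + (R.im - V.im) ^ 2) - ((A.re - V.re) ^ 2 + (A.im - V.im) ^ 2) := by
  obtain ⟨t, h1, h2⟩ := exists_coords_of_mem_line hR
  rw [dist_eq_dist_iff_coords] at hU hV
  rw [h1, h2]
  linear_combination t * (hV - hU)

lemma dist_eq_of_power_eq {A B C P Q R : ℂ} {k : ℝ} (hABC : cross A B C ≠ 0)
    (h : ∀ X ∈ ({A, B, C} : Set ℂ),
      ((R.re - (pivotCenter k X P).re) ^ 2 + (R.im - (pivotCenter k X P).im) ^ 2) -
        ((X.re - (pivotCenter k X P).re) ^ 2 + (X.im - (pivotCenter k X P).im) ^ 2) =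
      ((R.re - (pivotCenter (-k) X Q).re) ^ 2 + (R.im - (pivotCenter (-k) X Q).im) ^ 2) -
        ((X.re - (pivotCenter (-k) X Q).re) ^ 2 + (X.im - (pivotCenter (-k) X Q).im) ^ 2)) :
    dist R P = dist R Q := by
  have hA := h A (by simp)
  have hB := h B (by simp)
  have hC := h C (by simp)
  simp only [pivotCenter] at hA hB hC
  unfold cross at hABC
  have e1 : (R.re - P.re) + 2 * k * (R.im - P.im) =
      (R.re - Q.re) - 2 * k * (R.im - Q.im) := by
    apply mul_left_cancel₀ hABC
    linear_combination (-(C.im - A.im)) * (hB - hA) + (B.im - A.im) * (hC - hA)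
  have e2 : (R.im - P.im) - 2 * k * (R.re - P.re) =
      (R.im - Q.im) + 2 * k * (R.re - Q.re) := by
    apply mul_left_cancel₀ hABC
    linear_combination (C.re - A.re) * (hB - hA) - (B.re - A.re) * (hC - hA)
  rw [dist_comm, dist_comm R, Complex.dist_eq_re_im, Complex.dist_eq_re_im]
  congr 1
  have hk : 1 + 4 * k ^ 2 ≠ 0 := by positivity
  apply mul_left_cancel₀ hk
  linear_combination ((R.re - P.re) + 2 * k * (R.im - P.im) +
      ((R.re - Q.re) - 2 * k * (R.im - Q.im))) * e1 +
    ((R.im - P.im) - 2 * k * (R.re - P.re) + ((R.im - Q.im) + 2 * k * (R.re - Q.re))) * e2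

/-- A point concyclic with three distinct points of a circle lies on that circle. -/
lemma dist_eq_of_cospherical {X Y Z W O : ℂ} (hXY : X ≠ Y) (hXZ : X ≠ Z) (hYZ : Y ≠ Z)
    (hO : dist X O = dist Z O ∧ dist Y O = dist Z O)
    (h : Cospherical ({X, Y, Z, W} : Set ℂ)) : dist X O = dist W O := by
  obtain ⟨O', h1, h2, h3⟩ := exists_center_of_cospherical h
  rwa [center_unique (cross_ne_zero_of_dist_eq hXY hXZ hYZ hO.1 hO.2) hO.1 hO.2
    (h1.trans h3.symm) (h2.trans h3.symm)]

/- STATEMENT 8: With A', B', C' the second intersections of the pairs of circles and R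
the common point of AA', BB', CC', the point R is equidistant from the two generalized
Brocard points P and Q.  The plane is modelled by ℂ. -/

theorem R_equidistant_from_P_and_Q
    (A B C O : ℂ)
    -- triangle ABC is nondegenerate
    (hABC : AffineIndependent ℝ ![A, B, C])
    -- Γ is a circle with center O meeting the sidelines in the six points
    (Γ : EuclideanGeometry.Sphere ℂ) (hO : Γ.center = O)
    (A₁ A₂ B₁ B₂ C₁ C₂ : ℂ)
    (hA₁Γ : A₁ ∈ Γ) (hA₂Γ : A₂ ∈ Γ) (hB₁Γ : B₁ ∈ Γ)
    (hB₂Γ : B₂ ∈ Γ) (hC₁Γ : C₁ ∈ Γ) (hC₂Γ : C₂ ∈ Γ)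
    (hA₁ : A₁ ∈ line[ℝ, B, C]) (hA₂ : A₂ ∈ line[ℝ, B, C])
    (hB₁ : B₁ ∈ line[ℝ, C, A]) (hB₂ : B₂ ∈ line[ℝ, C, A])
    (hC₁ : C₁ ∈ line[ℝ, A, B]) (hC₂ : C₂ ∈ line[ℝ, A, B])
    -- the six points are distinct from each other and from the vertices
    (hdist : List.Pairwise (· ≠ ·) [A, B, C, A₁, A₂, B₁, B₂, C₁, C₂])
    -- P is the Miquel point of A₁B₁C₁ in ABC, Q that of A₂B₂C₂
    (P Q : ℂ)
    (hP₁ : Cospherical ({A, B₁, C₁, P} : Set ℂ))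
    (hP₂ : Cospherical ({B, C₁, A₁, P} : Set ℂ))
    (hP₃ : Cospherical ({C, A₁, B₁, P} : Set ℂ))
    (hQ₁ : Cospherical ({A, B₂, C₂, Q} : Set ℂ))
    (hQ₂ : Cospherical ({B, C₂, A₂, Q} : Set ℂ))
    (hQ₃ : Cospherical ({C, A₂, B₂, Q} : Set ℂ))
    -- A' is the second intersection of circles (AB₁C₁) and (AB₂C₂); B', C' analogous
    (A' B' C' : ℂ)
    (hA'₁ : Cospherical ({A, B₁, C₁, A'} : Set ℂ))
    (hA'₂ : Cospherical ({A, B₂, C₂, A'} : Set ℂ)) (hA'A : A' ≠ A)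
    (hB'₁ : Cospherical ({B, C₁, A₁, B'} : Set ℂ))
    (hB'₂ : Cospherical ({B, C₂, A₂, B'} : Set ℂ)) (hB'B : B' ≠ B)
    (hC'₁ : Cospherical ({C, A₁, B₁, C'} : Set ℂ))
    (hC'₂ : Cospherical ({C, A₂, B₂, C'} : Set ℂ)) (hC'C : C' ≠ C)
    -- R is the common point of the lines AA', BB', CC'
    (R : ℂ)
    (hRA : R ∈ line[ℝ, A, A']) (hRB : R ∈ line[ℝ, B, B']) (hRC : R ∈ line[ℝ, C, C'])
    :
    -- conclusion: RP = RQ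
    dist R P = dist R Q := by
  simp only [List.pairwise_cons, List.mem_cons, List.not_mem_nil, or_false, forall_eq_or_imp,
    forall_eq, IsEmpty.forall_iff, implies_true, List.Pairwise.nil, and_true, ne_eq] at hdist
  obtain ⟨⟨hAB, hAC, -, -, hAB₁, hAB₂, hAC₁, hAC₂⟩, ⟨hBC, hBA₁, hBA₂, -, -, hBC₁, hBC₂⟩,
    ⟨hCA₁, hCA₂, hCB₁, hCB₂, -, -⟩, ⟨hAA, hA₁B₁, -, hA₁C₁, -⟩, ⟨-, hA₂B₂, -, hA₂C₂⟩,
    ⟨hBB, hB₁C₁, -⟩, ⟨-, hB₂C₂⟩, hCC⟩ := hdist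
  have hCA : C ≠ A := fun h => hAC h.symm
  have hΔ := cross_ne_zero_of_affineIndependent hABC
  have hΔ' : cross B C A ≠ 0 := by rwa [cross_rotate]
  have hΔ'' : cross C A B ≠ 0 := by rwa [cross_rotate, cross_rotate]
  subst hO
  rw [EuclideanGeometry.mem_sphere] at hA₁Γ hA₂Γ hB₁Γ hB₂Γ hC₁Γ hC₂Γ
  obtain ⟨k, pA, pB, pC⟩ := exists_pivotCenter_of_miquel hAB hBC hCA hA₁ hB₁ hC₁ hBA₁ hCA₁ hCB₁
    hAB₁ hAC₁ hBC₁ hA₁B₁ hA₁C₁ hB₁C₁ hP₁ hP₂ hP₃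
  obtain ⟨l, qA, qB, qC⟩ := exists_pivotCenter_of_miquel hAB hBC hCA hA₂ hB₂ hC₂ hBA₂ hCA₂ hCB₂
    hAB₂ hAC₂ hBC₂ hA₂B₂ hA₂C₂ hB₂C₂ hQ₁ hQ₂ hQ₃
  obtain ⟨a, ha⟩ := exists_real_mul_eq hΔ hAB hAC hB₁ hB₂ hC₁ hC₂ hAB₁ hAB₂ hAC₁ hAC₂ hBB hCC
    (hB₁Γ.trans hB₂Γ.symm) (hC₁Γ.trans hC₂Γ.symm) (hB₁Γ.trans hC₁Γ.symm) pA qA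
  obtain ⟨b, hb⟩ := exists_real_mul_eq hΔ' hBC (Ne.symm hAB) hC₁ hC₂ hA₁ hA₂ hBC₁ hBC₂ hBA₁ hBA₂
    hCC hAA (hC₁Γ.trans hC₂Γ.symm) (hA₁Γ.trans hA₂Γ.symm) (hC₁Γ.trans hA₁Γ.symm) pB qB
  obtain ⟨c, hc⟩ := exists_real_mul_eq hΔ'' hCA (Ne.symm hBC) hA₁ hA₂ hB₁ hB₂ hCA₁ hCA₂ hCB₁ hCB₂
    hAA hBB (hA₁Γ.trans hA₂Γ.symm) (hB₁Γ.trans hB₂Γ.symm) (hA₁Γ.trans hB₁Γ.symm) pC qC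
  obtain rfl := pivot_add_eq_zero hAB hBC hCA ha hb hc
  have dA := dist_eq_of_cospherical hAB₁ hAC₁ hB₁C₁ pA hA'₁
  have dA' := dist_eq_of_cospherical hAB₂ hAC₂ hB₂C₂ qA hA'₂
  have dB := dist_eq_of_cospherical hBC₁ hBA₁ (Ne.symm hA₁C₁) pB hB'₁
  have dB' := dist_eq_of_cospherical hBC₂ hBA₂ (Ne.symm hA₂C₂) qB hB'₂
  have dC := dist_eq_of_cospherical hCA₁ hCB₁ hA₁B₁ pC hC'₁
  have dC' := dist_eq_of_cospherical hCA₂ hCB₂ hA₂B₂ qC hC'₂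
  apply dist_eq_of_power_eq (k := k) hΔ
  rintro X (rfl | rfl | rfl)
  · exact power_eq_of_mem_line hRA dA dA'
  · exact power_eq_of_mem_line hRB dB dB'
  · exact power_eq_of_mem_line hRC dC dC'
end

section
/- Let T_A = PA₁ ∩ QA₂, T_B = PB₁ ∩ QB₂, T_C = PC₁ ∩ QC₂. Then triangle T_AT_BT_C is inversely (i.e. with reversed orientation) similar to triangle ABC: there is an orientation-reversing similarity of the plane sending T_A to A, T_B to B, and T_C to C. -/
open EuclideanGeometry ComplexConjugate

lemma mul_conj_eq_of_mem_line {p q z : ℂ} (hz : z ∈ line[ℝ, p, q]) :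
    (z - p) * conj (q - p) = conj (z - p) * (q - p) := by
  obtain ⟨t, rfl⟩ := mem_affineSpan_pair_iff_exists_lineMap_eq.1 hz
  simp only [AffineMap.lineMap_apply, vsub_eq_sub, vadd_eq_add, Complex.real_smul,
    add_sub_cancel_right, map_mul, Complex.conj_ofReal]
  ring

/-- The unit number `(q - p) / conj (q - p)` encodes the direction of the line `p q`. -/
lemma sub_eq_direction_mul_conj {p q z w : ℂ} (hpq : p ≠ q) (hz : z ∈ line[ℝ, p, q])
    (hw : w ∈ line[ℝ, p, q]) :
    z - w = (q - p) / conj (q - p) * conj (z - w) := by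
  have h₀ : conj (q - p) ≠ 0 := (map_ne_zero _).2 (sub_ne_zero.2 hpq.symm)
  have h₁ := mul_conj_eq_of_mem_line hz
  have h₂ := mul_conj_eq_of_mem_line hw
  rw [div_mul_eq_mul_div, eq_div_iff h₀]
  simp only [map_sub] at *
  linear_combination h₁ - h₂

lemma eq_direction_mul_conj_of_mem_line {p q z d : ℂ} (hpq : q ≠ p) (hz : z ∈ line[ℝ, p, q])
    (h : q - p = d * conj (q - p)) : z - p = d * conj (z - p) := by
  have h₀ : conj (q - p) ≠ 0 := (map_ne_zero _).2 (sub_ne_zero.2 hpq)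
  have h₁ := mul_conj_eq_of_mem_line hz
  apply mul_right_cancel₀ h₀
  linear_combination h₁ + conj (z - p) * h

lemma direction_mul_conj {p q : ℂ} (hpq : p ≠ q) :
    (q - p) / conj (q - p) * conj ((q - p) / conj (q - p)) = 1 := by
  have h₀ : q - p ≠ 0 := sub_ne_zero.2 hpq.symm
  have h₁ : conj (q - p) ≠ 0 := (map_ne_zero _).2 h₀
  rw [map_div₀, Complex.conj_conj]
  field_simp

lemma EuclideanGeometry.Sphere.sub_mul_conj_sub {S : Sphere ℂ} {z : ℂ} (hz : z ∈ S) :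
    (z - S.center) * conj (z - S.center) = (S.radius : ℂ) ^ 2 := by
  rw [Complex.mul_conj', ← dist_eq_norm, mem_sphere.1 hz]

/-- The inscribed angle theorem, in terms of the directions `β`, `γ` of the lines `xy`, `xz`. -/
lemma EuclideanGeometry.Cospherical.direction_eq {x y z p β γ : ℂ}
    (h : Cospherical ({x, y, z, p} : Set ℂ)) (hy : y ≠ x) (hz : z ≠ x)
    (hβ : y - x = β * conj (y - x)) (hγ : z - x = γ * conj (z - x)) :
    β * (z - p) * conj (y - p) = γ * (y - p) * conj (z - p) := by
  obtain ⟨o, R, h⟩ := h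
  have key : ∀ w ∈ ({x, y, z, p} : Set ℂ), (w - o) * conj (w - o) = (R : ℂ) ^ 2 := fun w hw ↦
    Sphere.sub_mul_conj_sub (S := ⟨o, R⟩) (h w hw)
  have kx := key x (by simp)
  have ky := key y (by simp)
  have kz := key z (by simp)
  have kp := key p (by simp)
  have hR : (R : ℂ) ^ 2 ≠ 0 := by
    intro h0
    rw [h0] at kx ky
    simp only [mul_eq_zero, map_eq_zero, or_self, sub_eq_zero] at kx ky
    exact hy (ky.trans kx.symm)
  have nz : ∀ w, (w - o) * conj (w - o) = (R : ℂ) ^ 2 → w - o ≠ 0 := fun w hw h0 ↦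
    hR (by rw [← hw, h0, zero_mul])
  have nx := nz x kx
  have ny := nz y ky
  have nz' := nz z kz
  have np := nz p kp
  have chord : ∀ v w, (v - o) * conj (v - o) = (R : ℂ) ^ 2 →
      (w - o) * conj (w - o) = (R : ℂ) ^ 2 →
      (v - o) * (w - o) * conj (v - w) = -(R : ℂ) ^ 2 * (v - w) := fun v w hv hw ↦ by
    simp only [map_sub] at *
    linear_combination (w - o) * hv - (v - o) * hw
  have hyx := chord y x ky kx
  have hzx := chord z x kz kx
  have hyp := chord y p ky kp
  have hzp := chord z p kz kp
  have cy : conj (y - x) ≠ 0 := (map_ne_zero _).2 (sub_ne_zero.2 hy)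
  have cz : conj (z - x) ≠ 0 := (map_ne_zero _).2 (sub_ne_zero.2 hz)
  have e₁ : (y - o) * (x - o) = -(R : ℂ) ^ 2 * β := by
    apply mul_right_cancel₀ cy
    linear_combination hyx - (R : ℂ) ^ 2 * hβ
  have e₂ : (z - o) * (x - o) = -(R : ℂ) ^ 2 * γ := by
    apply mul_right_cancel₀ cz
    linear_combination hzx - (R : ℂ) ^ 2 * hγ
  have hp : conj (y - p) = -(R : ℂ) ^ 2 * (y - p) / ((y - o) * (p - o)) := by
    rw [eq_div_iff (mul_ne_zero ny np)]
    linear_combination hyp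
  have hp' : conj (z - p) = -(R : ℂ) ^ 2 * (z - p) / ((z - o) * (p - o)) := by
    rw [eq_div_iff (mul_ne_zero nz' np)]
    linear_combination hzp
  have hb : β * (z - o) = γ * (y - o) := by
    apply mul_left_cancel₀ hR
    linear_combination (z - o) * e₁ - (y - o) * e₂
  rw [hp, hp']
  field_simp
  linear_combination -(R : ℂ) ^ 2 * (z - p) * (y - p) * hb

/-- Intersections of a circle centered at `0` with a line of direction `α`. -/
lemma direction_mul_conj_eq_neg {α ρ x y : ℂ} (hx : x * conj x = ρ) (hy : y * conj y = ρ)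
    (hxy : x ≠ y) (h : x - y = α * conj (x - y)) : α * conj x = -y := by
  have hρ : ρ ≠ 0 := by
    rintro rfl
    simp only [mul_eq_zero, map_eq_zero, or_self] at hx hy
    exact hxy (hx.trans hy.symm)
  have hx₀ : x ≠ 0 := by
    rintro rfl
    exact hρ (by rw [← hx, zero_mul])
  have e : x * y = -α * ρ := by
    apply mul_right_cancel₀ (sub_ne_zero.2 hxy)
    rw [map_sub] at h
    linear_combination x * y * h + α * y * hx - α * x * hy
  apply mul_left_cancel₀ hx₀
  linear_combination α * hx + e

/-- Two triangles `a₁ b₁ c₁` and `a₂ b₂ c₂` inscribed in a circle centered at `0`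
are not inversely similar to the triangle formed by the lines `a₁ a₂`, `b₁ b₂`, `c₁ c₂`. -/
lemma inscribed_det_ne_zero {α β γ ρ a₁ a₂ b₁ b₂ c₁ c₂ : ℂ}
    (hα : α * conj α = 1) (hβ : β * conj β = 1) (hγ : γ * conj γ = 1)
    (hβγ : β ≠ γ) (hγα : γ ≠ α)
    (ha : α * conj a₁ = -a₂) (hb : β * conj b₁ = -b₂) (hc : γ * conj c₁ = -c₂)
    (ha' : a₁ * conj a₁ = ρ) (hb' : b₁ * conj b₁ = ρ) (hc' : c₁ * conj c₁ = ρ)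
    (h₁ : a₁ ≠ b₁) (h₂ : a₂ ≠ b₂) :
    a₁ * (β - γ) + b₁ * (γ - α) + c₁ * (α - β) ≠ 0 := by
  intro h
  have h' : a₂ * (β - γ) + b₂ * (γ - α) + c₂ * (α - β) = 0 := by
    have hh := congrArg conj h
    simp only [map_add, map_sub, map_mul, map_zero] at hh
    linear_combination α * β * γ * hh + (β - γ) * ha + (γ - α) * hb + (α - β) * hc
      + (-α * γ * conj a₁ + α * γ * conj c₁) * hβ + (α * β * conj a₁ - α * β * conj b₁) * hγ
      + (β * γ * conj b₁ - β * γ * conj c₁) * hα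
  have pa : a₁ * a₂ = -ρ * α := by linear_combination -α * ha' + a₁ * ha
  have pb : b₁ * b₂ = -ρ * β := by linear_combination -β * hb' + b₁ * hb
  have pc : c₁ * c₂ = -ρ * γ := by linear_combination -γ * hc' + c₁ * hc
  have : (a₁ - b₁) * (a₂ - b₂) * ((β - γ) * (γ - α)) = 0 := by
    linear_combination -(α - β) ^ 2 * pc + (β - γ) * (β - α) * pa + (γ - α) * (β - α) * pb
      + (α - β) * c₁ * h' - (a₂ * (β - γ) + b₂ * (γ - α)) * h
  simp only [mul_eq_zero, sub_eq_zero, h₁, h₂, hβγ, hγα, or_self] at this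

/-- If three directions rotated by `κ` (resp. `κ'`) at `a₁, b₁, c₁` (resp. `a₂, b₂, c₂`)
give concurrent lines, then the rotations are opposite. -/
lemma rotation_mul_eq_one {α β γ κ κ' P Q a₁ a₂ b₁ b₂ c₁ c₂ : ℂ}
    (hD : a₁ * (β - γ) + b₁ * (γ - α) + c₁ * (α - β) ≠ 0)
    (ha : P - α * κ * conj P = a₁ + κ * a₂) (hb : P - β * κ * conj P = b₁ + κ * b₂)
    (hc : P - γ * κ * conj P = c₁ + κ * c₂)
    (ha' : Q - α * κ' * conj Q = a₂ + κ' * a₁) (hb' : Q - β * κ' * conj Q = b₂ + κ' * b₁)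
    (hc' : Q - γ * κ' * conj Q = c₂ + κ' * c₁) : κ * κ' = 1 := by
  apply mul_right_cancel₀ hD
  linear_combination (β - γ) * ha + (γ - α) * hb + (α - β) * hc
    - κ * ((β - γ) * ha' + (γ - α) * hb' + (α - β) * hc')

lemma one_add_mul_eq_of_isosceles {α κ κ' P Q T a₁ a₂ : ℂ}
    (h₁₂ : a₁ ≠ a₂)
    (hP : P - α * κ * conj P = a₁ + κ * a₂) (hQ : Q - α * κ' * conj Q = a₂ + κ' * a₁)
    (hTP : T - P = α * κ * conj (T - P)) (hTQ : T - Q = α * κ' * conj (T - Q))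
    (hκ : κ * κ' = 1) (hκ₁ : κ ≠ 1) :
    1 + κ ≠ 0 ∧ T * (1 + κ) = P - α * κ * conj P := by
  rw [map_sub] at hTP hTQ
  have e₁ : T - α * κ * conj T = a₁ + κ * a₂ := by linear_combination hTP + hP
  have e₂ : κ * T - α * conj T = κ * a₂ + a₁ := by
    linear_combination κ * hTQ + κ * hQ + (α * conj T + a₁) * hκ
  have e₃ : T = -α * conj T := by
    apply mul_left_cancel₀ (sub_ne_zero.2 hκ₁)
    linear_combination e₂ - e₁
  refine ⟨fun h ↦ h₁₂ ?_, by linear_combination hTP + κ * e₃⟩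
  linear_combination -e₁ + e₃ - (α * conj T + a₂) * h

/-- Three lines with pairwise different directions forming a triangle have no common point. -/
lemma not_common_point {A B C α β γ Z : ℂ} (hCA' : C ≠ A) (hαβ : α ≠ β) (hβγ : β ≠ γ)
    (hBC : C - B = α * conj (C - B))
    (hα : Z - B = α * conj (Z - B)) (hβ : Z - C = β * conj (Z - C))
    (hγ : Z - A = γ * conj (Z - A)) (hCA : A - C = β * conj (A - C)) : False := by
  have hC : conj (Z - C) = 0 := by
    apply (mul_eq_zero.1 _).resolve_left (sub_ne_zero.2 hαβ)
    simp only [map_sub] at *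
    linear_combination hβ + hBC - hα
  have hA : conj (Z - A) = 0 := by
    apply (mul_eq_zero.1 _).resolve_left (sub_ne_zero.2 hβγ)
    simp only [map_sub] at *
    linear_combination hγ + hCA - hβ
  rw [map_eq_zero, sub_eq_zero] at hC hA
  exact hCA' (hC.symm.trans hA)

/-- Since the Miquel point `Q` of `x y z` is not on the sideline through `x`, the Miquel point `P`
is not the second point `w` on this sideline. -/
lemma ne_miquel_of_mem_line {A B C α β γ P Q T x y z w : ℂ} (hCA' : C ≠ A) (hαβ : α ≠ β)
    (hβγ : β ≠ γ) (hBC : C - B = α * conj (C - B))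
    (hCA : A - C = β * conj (A - C)) (hx : x - B = α * conj (x - B))
    (hy : y - C = β * conj (y - C)) (hz : z - A = γ * conj (z - A))
    (hwx : w ≠ x) (hw : w - x = α * conj (w - x))
    (hxy : β * (x - Q) * conj (y - Q) = α * (y - Q) * conj (x - Q))
    (hzx : α * (z - Q) * conj (x - Q) = γ * (x - Q) * conj (z - Q))
    (hTP : T ∈ line[ℝ, P, w]) (hTQ : T ∈ line[ℝ, Q, x]) : w ≠ P := by
  rintro rfl
  have hwQ : w ∈ line[ℝ, Q, x] := by
    rw [Set.pair_eq_singleton, AffineSubspace.mem_affineSpan_singleton] at hTP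
    rwa [← hTP]
  have hxQ : x - Q ≠ 0 := by
    intro h
    obtain rfl := sub_eq_zero.1 h
    rw [Set.pair_eq_singleton, AffineSubspace.mem_affineSpan_singleton] at hwQ
    exact hwx hwQ
  have hQx : x - Q = α * conj (x - Q) := by
    have h := mul_conj_eq_of_mem_line hwQ
    apply mul_left_cancel₀ ((map_ne_zero (starRingEnd ℂ)).2 (sub_ne_zero.2 hwx))
    simp only [map_sub] at *
    linear_combination -h + (conj x - conj Q) * hw
  have hQy : y - Q = β * conj (y - Q) := by
    apply mul_left_cancel₀ hxQ
    linear_combination (y - Q) * hQx - hxy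
  have hQz : z - Q = γ * conj (z - Q) := by
    apply mul_left_cancel₀ hxQ
    linear_combination (z - Q) * hQx + hzx
  refine not_common_point (Z := Q) hCA' hαβ hβγ hBC ?_ ?_ ?_ hCA
  · rw [map_sub] at *; linear_combination hx - hQx
  · rw [map_sub] at *; linear_combination hy - hQy
  · rw [map_sub] at *; linear_combination hz - hQz

lemma collinear_of_direction_eq {p q r α : ℂ} (hpq : p ≠ q) (hq : q - p = α * conj (q - p))
    (hr : r - q = α * conj (r - q)) : Collinear ℝ {p, q, r} := by
  have h₀ : q - p ≠ 0 := sub_ne_zero.2 hpq.symm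
  have h₁ : conj (q - p) ≠ 0 := (map_ne_zero _).2 h₀
  obtain ⟨t, ht⟩ : ∃ t : ℝ, (r - q) / (q - p) = t := by
    rw [← Complex.conj_eq_iff_real, map_div₀, div_eq_div_iff h₁ h₀]
    linear_combination conj (r - q) * hq - conj (q - p) * hr
  rw [div_eq_iff h₀] at ht
  rw [collinear_iff_of_mem (p₀ := p) (by simp)]
  refine ⟨q - p, ?_⟩
  rintro w (rfl | rfl | rfl)
  · exact ⟨0, by simp⟩
  · exact ⟨1, by simp⟩
  · refine ⟨1 + t, ?_⟩
    rw [vadd_eq_add, Complex.real_smul]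
    push_cast
    linear_combination ht

/-- The points `P - α κ P̄`, `P - β κ P̄`, `P - γ κ P̄` form a triangle inversely similar to any
triangle whose sides have directions `α`, `β`, `γ`. -/
lemma exists_antisimilarity {A B C O P α β γ κ T_A T_B T_C : ℂ} (hCB : C ≠ B) (hAC : A ≠ C)
    (hBA : B ≠ A) (hβγ : β ≠ γ) (hκ : κ ≠ 0) (hκ' : 1 + κ ≠ 0)
    (hBC : C - B = α * conj (C - B)) (hCA : A - C = β * conj (A - C))
    (hAB : B - A = γ * conj (B - A)) (hα : α * conj α = 1) (hβ : β * conj β = 1)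
    (hγ : γ * conj γ = 1) (hT : ¬ Collinear ℝ ({T_A, T_B, T_C} : Set ℂ))
    (hTA : (T_A - O) * (1 + κ) = P - α * κ * conj P)
    (hTB : (T_B - O) * (1 + κ) = P - β * κ * conj P)
    (hTC : (T_C - O) * (1 + κ) = P - γ * κ * conj P) :
    ∃ a b : ℂ, a ≠ 0 ∧ A = a * conj T_A + b ∧ B = a * conj T_B + b ∧ C = a * conj T_C + b := by
  have hP : P ≠ 0 := by
    rintro rfl
    simp only [map_zero, mul_zero, sub_zero, mul_eq_zero, hκ', or_false, sub_eq_zero]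
      at hTA hTB hTC
    rw [hTA, hTB, hTC] at hT
    simp [collinear_singleton] at hT
  have hκc : conj κ ≠ 0 := (map_ne_zero _).2 hκ
  have hκc' : 1 + conj κ ≠ 0 := by simpa using (map_ne_zero (starRingEnd ℂ)).2 hκ'
  have hα' : conj (C - B) = conj α * (C - B) := by
    linear_combination -conj (C - B) * hα - conj α * hBC
  have hβ' : conj (A - C) = conj β * (A - C) := by
    linear_combination -conj (A - C) * hβ - conj β * hCA
  have hγ' : conj (B - A) = conj γ * (B - A) := by
    linear_combination -conj (B - A) * hγ - conj γ * hAB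
  have hβγ' : conj γ - conj β ≠ 0 := by
    rw [← map_sub]
    exact (map_ne_zero _).2 (sub_ne_zero.2 hβγ.symm)
  have nAC := sub_ne_zero.2 hAC
  have nBA := sub_ne_zero.2 hBA
  have nCB := sub_ne_zero.2 hCB
  have cA := congrArg conj hTA
  have cB := congrArg conj hTB
  have cC := congrArg conj hTC
  simp only [map_mul, map_sub, map_add, map_one, Complex.conj_conj] at cA cB cC hα' hβ' hγ'
  have hs : (B - C) * (conj α - conj β) = (conj γ - conj β) * (B - A) := by
    linear_combination hα' + hβ' + hγ'
  set a : ℂ := (B - C) * (1 + conj κ) / (conj κ * P * (conj γ - conj β)) with ha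
  have ha' : a * (conj κ * P * (conj γ - conj β)) = (B - C) * (1 + conj κ) := by
    rw [ha]; field_simp
  refine ⟨a, A - a * conj T_A, ?_, by ring, ?_, ?_⟩
  · exact div_ne_zero (mul_ne_zero (sub_ne_zero.2 hCB.symm) hκc')
      (mul_ne_zero (mul_ne_zero hκc hP) hβγ')
  · apply mul_right_cancel₀ (mul_ne_zero hκc' hβγ')
    linear_combination -(1 + conj κ) * hs - (conj α - conj β) * ha'
      - a * (conj γ - conj β) * (cB - cA)
  · apply mul_right_cancel₀ (mul_ne_zero hκc' hβγ')
    linear_combination -(1 + conj κ) * hs - (conj α - conj γ) * ha'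
      - a * (conj γ - conj β) * (cC - cA)

/-- The lines joining the Miquel point to three points on the sidelines are obtained from the
sidelines by a common rotation. -/
lemma exists_rotation {α β γ u v w : ℂ} (hα : α ≠ 0) (hu : u ≠ 0)
    (huv : β * u * conj v = α * v * conj u) (huw : α * w * conj u = γ * u * conj w) :
    ∃ κ, u = α * κ * conj u ∧ v = β * κ * conj v ∧ w = γ * κ * conj w := by
  have hu' : conj u ≠ 0 := (map_ne_zero _).2 hu
  refine ⟨u / (α * conj u), ?_, ?_, ?_⟩
  · field_simp
  · field_simp
    linear_combination -huv
  · field_simp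
    linear_combination huw

lemma sub_rotation_eq {α κ O P x y : ℂ} (h : x - P = α * κ * conj (x - P))
    (hx : α * conj (x - O) = -(y - O)) :
    (P - O) - α * κ * conj (P - O) = (x - O) + κ * (y - O) := by
  simp only [map_sub] at *
  linear_combination -h - κ * hx

/- STATEMENT 10: Triangle T_AT_BT_C is inversely similar to triangle ABC: there is an
orientation-reversing similarity of the plane (in ℂ: z ↦ a * conj z + b with a ≠ 0)
sending T_A to A, T_B to B and T_C to C.  The plane is modelled by ℂ. -/

theorem first_generalized_brocard_triangle_inversely_similar
    (A B C O : ℂ)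
    -- triangle ABC is nondegenerate
    (hABC : AffineIndependent ℝ ![A, B, C])
    -- Γ is a circle with center O meeting the sidelines in the six points
    (Γ : EuclideanGeometry.Sphere ℂ) (hO : Γ.center = O)
    (A₁ A₂ B₁ B₂ C₁ C₂ : ℂ)
    (hA₁Γ : A₁ ∈ Γ) (hA₂Γ : A₂ ∈ Γ) (hB₁Γ : B₁ ∈ Γ)
    (hB₂Γ : B₂ ∈ Γ) (hC₁Γ : C₁ ∈ Γ) (hC₂Γ : C₂ ∈ Γ)
    (hA₁ : A₁ ∈ line[ℝ, B, C]) (hA₂ : A₂ ∈ line[ℝ, B, C])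
    (hB₁ : B₁ ∈ line[ℝ, C, A]) (hB₂ : B₂ ∈ line[ℝ, C, A])
    (hC₁ : C₁ ∈ line[ℝ, A, B]) (hC₂ : C₂ ∈ line[ℝ, A, B])
    -- the six points are distinct from each other and from the vertices
    (hdist : List.Pairwise (· ≠ ·) [A, B, C, A₁, A₂, B₁, B₂, C₁, C₂])
    -- P is the Miquel point of A₁B₁C₁ in ABC, Q that of A₂B₂C₂
    (P Q : ℂ)
    (hP₁ : Cospherical ({A, B₁, C₁, P} : Set ℂ))
    (hP₂ : Cospherical ({B, C₁, A₁, P} : Set ℂ))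
    (hP₃ : Cospherical ({C, A₁, B₁, P} : Set ℂ))
    (hQ₁ : Cospherical ({A, B₂, C₂, Q} : Set ℂ))
    (hQ₂ : Cospherical ({B, C₂, A₂, Q} : Set ℂ))
    (hQ₃ : Cospherical ({C, A₂, B₂, Q} : Set ℂ))
    -- T_A = PA₁ ∩ QA₂, T_B = PB₁ ∩ QB₂, T_C = PC₁ ∩ QC₂
    (T_A T_B T_C : ℂ)
    (hTA₁ : T_A ∈ line[ℝ, P, A₁]) (hTA₂ : T_A ∈ line[ℝ, Q, A₂])
    (hTB₁ : T_B ∈ line[ℝ, P, B₁]) (hTB₂ : T_B ∈ line[ℝ, Q, B₂])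
    (hTC₁ : T_C ∈ line[ℝ, P, C₁]) (hTC₂ : T_C ∈ line[ℝ, Q, C₂])
    (hT : ¬ Collinear ℝ ({T_A, T_B, T_C} : Set ℂ))
    :
    -- conclusion: an orientation-reversing similarity sends T_A, T_B, T_C to A, B, C
    ∃ a b : ℂ, a ≠ 0 ∧
      A = a * (starRingEnd ℂ) T_A + b ∧
      B = a * (starRingEnd ℂ) T_B + b ∧
      C = a * (starRingEnd ℂ) T_C + b := by
  subst hO
  rw [affineIndependent_iff_not_collinear_set] at hABC
  simp only [List.pairwise_cons, List.mem_cons, List.not_mem_nil, or_false, forall_eq_or_imp,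
    forall_eq, List.Pairwise.nil, and_true, false_imp_iff, implies_true] at hdist
  obtain ⟨⟨nAB, nAC, nAA₁, nAA₂, nAB₁, nAB₂, nAC₁, nAC₂⟩, ⟨nBC, nBA₁, nBA₂, nBB₁, nBB₂, nBC₁, nBC₂⟩,
    ⟨nCA₁, nCA₂, nCB₁, nCB₂, nCC₁, nCC₂⟩, ⟨nA, nA₁B₁, -, -, -⟩, ⟨-, nA₂B₂, -, -⟩, ⟨nB, -, -⟩,
    ⟨-, -⟩, nC⟩ := hdist
  have hα := direction_mul_conj nBC
  have hβ := direction_mul_conj nAC.symm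
  have hγ := direction_mul_conj nAB
  have dBC {z w : ℂ} := @sub_eq_direction_mul_conj B C z w nBC
  have dCA {z w : ℂ} := @sub_eq_direction_mul_conj C A z w nAC.symm
  have dAB {z w : ℂ} := @sub_eq_direction_mul_conj A B z w nAB
  set α := (C - B) / conj (C - B)
  set β := (A - C) / conj (A - C)
  set γ := (B - A) / conj (B - A)
  have mB := left_mem_affineSpan_pair ℝ B C
  have mC := right_mem_affineSpan_pair ℝ B C
  have mC' := left_mem_affineSpan_pair ℝ C A
  have mA := right_mem_affineSpan_pair ℝ C A
  have mA' := left_mem_affineSpan_pair ℝ A B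
  have mB' := right_mem_affineSpan_pair ℝ A B
  have hBC := dBC mC mB
  have hCA := dCA mA mC'
  have hAB := dAB mB' mA'
  have hαβ : α ≠ β := fun h ↦ hABC <| by
    have := collinear_of_direction_eq nBC hBC (h ▸ hCA)
    rwa [Set.pair_comm, Set.insert_comm] at this
  have hβγ : β ≠ γ := fun h ↦ hABC <| by
    have := collinear_of_direction_eq nAC.symm hCA (h ▸ hAB)
    rwa [Set.insert_comm, Set.pair_comm] at this
  have hγα : γ ≠ α := fun h ↦ hABC <| collinear_of_direction_eq nAB hAB (h ▸ hBC)
  -- the inscribed angle theorem in the three Miquel circles of `P` and of `Q`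
  have eP₁ := hP₁.direction_eq nAB₁.symm nAC₁.symm (dCA hB₁ mA) (dAB hC₁ mA')
  have eP₂ := hP₂.direction_eq nBC₁.symm nBA₁.symm (dAB hC₁ mB') (dBC hA₁ mB)
  have eP₃ := hP₃.direction_eq nCA₁.symm nCB₁.symm (dBC hA₁ mC) (dCA hB₁ mC')
  have eQ₁ := hQ₁.direction_eq nAB₂.symm nAC₂.symm (dCA hB₂ mA) (dAB hC₂ mA')
  have eQ₂ := hQ₂.direction_eq nBC₂.symm nBA₂.symm (dAB hC₂ mB') (dBC hA₂ mB)
  have eQ₃ := hQ₃.direction_eq nCA₂.symm nCB₂.symm (dBC hA₂ mC) (dCA hB₂ mC')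
  have nPA : A₁ ≠ P := ne_miquel_of_mem_line nAC.symm hαβ hβγ hBC hCA (dBC hA₂ mB)
    (dCA hB₂ mC') (dAB hC₂ mA') nA (dBC hA₁ hA₂) eQ₃.symm eQ₂.symm
    hTA₁ hTA₂
  have nPB : B₁ ≠ P := ne_miquel_of_mem_line nAB hβγ hγα hCA hAB (dCA hB₂ mC')
    (dAB hC₂ mA') (dBC hA₂ mB) nB (dCA hB₁ hB₂) eQ₁.symm eQ₃.symm
    hTB₁ hTB₂
  have nPC : C₁ ≠ P := ne_miquel_of_mem_line nBC hγα hαβ hAB hBC (dAB hC₂ mA')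
    (dBC hA₂ mB) (dCA hB₂ mC') nC (dAB hC₁ hC₂) eQ₂.symm eQ₁.symm
    hTC₁ hTC₂
  have nQA : A₂ ≠ Q := ne_miquel_of_mem_line nAC.symm hαβ hβγ hBC hCA (dBC hA₁ mB)
    (dCA hB₁ mC') (dAB hC₁ mA') nA.symm (dBC hA₂ hA₁) eP₃.symm eP₂.symm
    hTA₂ hTA₁
  have nQB : B₂ ≠ Q := ne_miquel_of_mem_line nAB hβγ hγα hCA hAB (dCA hB₁ mC')
    (dAB hC₁ mA') (dBC hA₁ mB) nB.symm (dCA hB₂ hB₁) eP₁.symm eP₃.symm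
    hTB₂ hTB₁
  have nQC : C₂ ≠ Q := ne_miquel_of_mem_line nBC hγα hαβ hAB hBC (dAB hC₁ mA')
    (dBC hA₁ mB) (dCA hB₁ mC') nC.symm (dAB hC₂ hC₁) eP₂.symm eP₁.symm
    hTC₂ hTC₁
  have hα₀ : α ≠ 0 := left_ne_zero_of_mul_eq_one hα
  obtain ⟨κ, hPA, hPB, hPC⟩ := exists_rotation hα₀ (sub_ne_zero.2 nPA) eP₃.symm eP₂.symm
  obtain ⟨κ', hQA, hQB, hQC⟩ := exists_rotation hα₀ (sub_ne_zero.2 nQA) eQ₃.symm eQ₂.symm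
  have sA₁ := Γ.sub_mul_conj_sub hA₁Γ
  have sA₂ := Γ.sub_mul_conj_sub hA₂Γ
  have sB₁ := Γ.sub_mul_conj_sub hB₁Γ
  have sB₂ := Γ.sub_mul_conj_sub hB₂Γ
  have sC₁ := Γ.sub_mul_conj_sub hC₁Γ
  have sC₂ := Γ.sub_mul_conj_sub hC₂Γ
  have chord {δ x y ρ : ℂ} (hx : (x - Γ.center) * conj (x - Γ.center) = ρ)
      (hy : (y - Γ.center) * conj (y - Γ.center) = ρ) (hxy : x ≠ y)
      (h : x - y = δ * conj (x - y)) : δ * conj (x - Γ.center) = -(y - Γ.center) :=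
    direction_mul_conj_eq_neg hx hy (sub_left_injective.ne hxy) (by simpa using h)
  have kA₁ := chord sA₁ sA₂ nA (dBC hA₁ hA₂)
  have kA₂ := chord sA₂ sA₁ nA.symm (dBC hA₂ hA₁)
  have kB₁ := chord sB₁ sB₂ nB (dCA hB₁ hB₂)
  have kB₂ := chord sB₂ sB₁ nB.symm (dCA hB₂ hB₁)
  have kC₁ := chord sC₁ sC₂ nC (dAB hC₁ hC₂)
  have kC₂ := chord sC₂ sC₁ nC.symm (dAB hC₂ hC₁)
  have rPA := sub_rotation_eq hPA kA₁
  have rQA := sub_rotation_eq hQA kA₂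
  have rPB := sub_rotation_eq hPB kB₁
  have rQB := sub_rotation_eq hQB kB₂
  have rPC := sub_rotation_eq hPC kC₁
  have rQC := sub_rotation_eq hQC kC₂
  have hD := inscribed_det_ne_zero hα hβ hγ hβγ hγα kA₁ kB₁ kC₁ sA₁ sB₁ sC₁
    (sub_left_injective.ne nA₁B₁) (sub_left_injective.ne nA₂B₂)
  have hκ := rotation_mul_eq_one hD rPA rPB rPC rQA rQB rQC
  have hκ₁ : κ ≠ 1 := by
    rintro rfl
    have on_line {δ x y : ℂ} (h : x - P = δ * 1 * conj (x - P)) (hxy : x - y = δ * conj (x - y)) :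
        P - y = δ * conj (P - y) := by
      simp only [map_sub] at *
      linear_combination hxy - h
    exact not_common_point nAC.symm hαβ hβγ hBC (on_line hPA (dBC hA₁ mB))
      (on_line hPB (dCA hB₁ mC')) (on_line hPC (dAB hC₁ mA')) hCA
  have perp {δ x y T : ℂ} (hxy : x ≠ y) (hxP : x ≠ P) (hyQ : y ≠ Q)
      (hP : x - P = δ * κ * conj (x - P)) (hQ : y - Q = δ * κ' * conj (y - Q))
      (rP : P - Γ.center - δ * κ * conj (P - Γ.center) = x - Γ.center + κ * (y - Γ.center))
      (rQ : Q - Γ.center - δ * κ' * conj (Q - Γ.center) = y - Γ.center + κ' * (x - Γ.center))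
      (hT₁ : T ∈ line[ℝ, P, x]) (hT₂ : T ∈ line[ℝ, Q, y]) :
      1 + κ ≠ 0 ∧ (T - Γ.center) * (1 + κ) = P - Γ.center - δ * κ * conj (P - Γ.center) :=
    one_add_mul_eq_of_isosceles (sub_left_injective.ne hxy) rP rQ
      (by simpa using eq_direction_mul_conj_of_mem_line hxP hT₁ hP)
      (by simpa using eq_direction_mul_conj_of_mem_line hyQ hT₂ hQ) hκ hκ₁
  obtain ⟨hκ', tA⟩ := perp nA nPA nQA hPA hQA rPA rQA hTA₁ hTA₂
  obtain ⟨-, tB⟩ := perp nB nPB nQB hPB hQB rPB rQB hTB₁ hTB₂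
  obtain ⟨-, tC⟩ := perp nC nPC nQC hPC hQC rPC rQC hTC₁ hTC₂
  exact exists_antisimilarity nBC.symm nAC nAB.symm hβγ (left_ne_zero_of_mul_eq_one hκ) hκ'
    hBC hCA hAB hα hβ hγ hT tA tB tC
end
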